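/- If H is an algebraic k-hypergraph, P is a d-dimensional k-template, and L(ℝ^d,P) is semialgebraically immersible into H, then L(ℝ^d,P) is embeddable into H. -/

import Mathlib

open Cardinal

universe u v

/-- `f` is one-to-one in each coordinate: if `a` and `b` differ in exactly one
coordinate, then `f a ≠ f b`. -/
def OneToOneEachCoord {d : ℕ} {X C : Type*} (f : (Fin d → X) → C) : Prop :=
  ∀ a b : Fin d → X, (∃ i, a i ≠ b i ∧ ∀ j, j ≠ i → a j = b j) → f a ≠ f b

/-- `Q` is a homomorphic image of the template `P`: there is a surjection of `P`
onto `Q` preserving coordinate equalities. -/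
def IsHomImage {d : ℕ} {α β : Type*} (P : Finset (Fin d → α)) (Q : Finset (Fin d → β)) : Prop :=
  ∃ f : (Fin d → α) → (Fin d → β),
    (∀ x ∈ P, f x ∈ Q) ∧ (∀ y ∈ Q, ∃ x ∈ P, f x = y) ∧
    (∀ x ∈ P, ∀ y ∈ P, ∀ i, x i = y i → f x i = f y i)

/-- The edge set of the template hypergraph `L(X^d, P)`: the edges are the
`k`-element subsets of `X^d` that are homomorphic images of `P`. -/
def LEdges (k : ℕ) {d : ℕ} {α : Type*} (P : Finset (Fin d → α)) (X : Type*) :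
    Set (Finset (Fin d → X)) :=
  {Q | Q.card = k ∧ IsHomImage P Q}

/-- Image of a finset (with classical decidable equality). -/
noncomputable def fimg {V W : Type*} (g : V → W) (e : Finset V) : Finset W :=
  @Finset.image _ _ (Classical.decEq W) g e

/-- `g` is an embedding of the hypergraph with edge set `E₁` into the one with
edge set `E₂`: an injection on vertices mapping every edge to an edge. -/
def IsHGEmbedding {V W : Type*} (E₁ : Set (Finset V)) (E₂ : Set (Finset W)) (g : V → W) : Prop :=
  Function.Injective g ∧ ∀ e ∈ E₁, fimg g e ∈ E₂

def Embeddable {V W : Type*} (E₁ : Set (Finset V)) (E₂ : Set (Finset W)) : Prop :=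
  ∃ g, IsHGEmbedding E₁ E₂ g

/-- The hypergraph with edge set `E` has a coloring with at most `κ` colors
that is not constant on any edge. -/
def ProperlyColorable {V : Type u} (E : Set (Finset V)) (κ : Cardinal.{u}) : Prop :=
  ∃ (C : Type u) (φ : V → C), #C ≤ κ ∧ ∀ e ∈ E, ∃ x ∈ e, ∃ y ∈ e, φ x ≠ φ y

/-- The chromatic number: the least `κ` admitting a proper `κ`-coloring. -/
noncomputable def chromaticNumber {V : Type u} (E : Set (Finset V)) : Cardinal.{u} :=
  sInf {κ | ProperlyColorable E κ}

/-- The edge set of the zero `k`-hypergraph of a `(k,n)`-ary real polynomial: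
the `k`-element subsets of `ℝ^n` admitting an enumeration on which `p` vanishes. -/
def zeroEdges (k n : ℕ) (p : MvPolynomial (Fin k × Fin n) ℝ) : Set (Finset (Fin n → ℝ)) :=
  {s | ∃ a : Fin k → (Fin n → ℝ), Function.Injective a ∧
        fimg a Finset.univ = s ∧ MvPolynomial.eval (fun v => a v.1 v.2) p = 0}

/-- An immersion of `L(X^d, P)` into the `k`-hypergraph with vertices `V` and edges `E`:
a map one-to-one in each coordinate sending every edge on which it is injective
to an edge of the target. -/
def IsImmersion {d : ℕ} {α X V : Type*} (k : ℕ) (P : Finset (Fin d → α))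
    (E : Set (Finset V)) (f : (Fin d → X) → V) : Prop :=
  OneToOneEachCoord f ∧ ∀ Q ∈ LEdges k P X, Set.InjOn f ↑Q → fimg f Q ∈ E

/-- Terms of the first-order language of ordered fields `{+,-,×,0,1,≤}`,
with variables indexed by `ℕ`. -/
inductive OFTerm : Type
  | var : ℕ → OFTerm
  | zero : OFTerm
  | one : OFTerm
  | add : OFTerm → OFTerm → OFTerm
  | mul : OFTerm → OFTerm → OFTerm
  | neg : OFTerm → OFTerm

/-- First-order formulas of the language of ordered fields (with equality;
`≠`, `∨`, `→`, `∀`, `<` etc. are expressible from `=`, `≤`, `¬`, `∧`, `∃`). -/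
inductive OFFml : Type
  | eq : OFTerm → OFTerm → OFFml
  | le : OFTerm → OFTerm → OFFml
  | not : OFFml → OFFml
  | and : OFFml → OFFml → OFFml
  | ex : ℕ → OFFml → OFFml

def OFTerm.eval (v : ℕ → ℝ) : OFTerm → ℝ
  | var i => v i
  | zero => 0
  | one => 1
  | add s t => s.eval v + t.eval v
  | mul s t => s.eval v * t.eval v
  | neg t => - t.eval v

/-- Realization (satisfaction) of a formula in the ordered field `ℝ`
under the valuation `v`. -/
def OFFml.Realize (v : ℕ → ℝ) : OFFml → Prop
  | eq s t => s.eval v = t.eval v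
  | le s t => s.eval v ≤ t.eval v
  | not φ => ¬ φ.Realize v
  | and φ ψ => φ.Realize v ∧ ψ.Realize v
  | ex i φ => ∃ r : ℝ, φ.Realize (Function.update v i r)

def OFTerm.fv : OFTerm → Finset ℕ
  | var i => {i}
  | zero => ∅
  | one => ∅
  | add s t => s.fv ∪ t.fv
  | mul s t => s.fv ∪ t.fv
  | neg t => t.fv

/-- The free variables of a formula. -/
def OFFml.fv : OFFml → Finset ℕ
  | eq s t => s.fv ∪ t.fv
  | le s t => s.fv ∪ t.fv
  | not φ => φ.fv
  | and φ ψ => φ.fv ∪ ψ.fv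
  | ex i φ => φ.fv.erase i

/-- The graph of `f : ℝ^d → ℝ^n` is semialgebraic, i.e. first-order definable with
parameters in the ordered field `ℝ`: variables `0,…,d-1` stand for the input,
`d,…,d+n-1` for the output, and all remaining variables are parameters. -/
def IsSemialgebraicGraph (d n : ℕ) (f : (Fin d → ℝ) → (Fin n → ℝ)) : Prop :=
  ∃ (θ : OFFml) (params : ℕ → ℝ),
    ∀ (z : Fin d → ℝ) (x : Fin n → ℝ),
      f z = x ↔ θ.Realize (fun i =>
        if h : i < d then z ⟨i, h⟩
        else if h' : i - d < n then x ⟨i - d, h'⟩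
        else params i)


/-- A point of an open interval can be moved to any larger point of it by an order automorphism
of `ℝ` supported on that interval. -/
lemma exists_orderIso_fix_of_le {a w z b : ℝ} (haw : a < w) (hwz : w ≤ z) (hzb : z < b) :
    ∃ h : ℝ ≃o ℝ, h w = z ∧ ∀ t, t ≤ a ∨ b ≤ t → h t = t := by
  have ha : 0 < w - a := by linarith
  have hb : 0 < b - w := by linarith
  set s := (z - a) / (w - a) with hs
  set σ := (b - z) / (b - w) with hσ
  have hs1 : 1 ≤ s := by rw [hs, le_div_iff₀ ha]; linarith
  have hσ0 : 0 < σ := div_pos (by linarith) hb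
  have hσ1 : σ ≤ 1 := by rw [hσ, div_le_iff₀ hb]; linarith
  let F : ℝ → ℝ := fun t => max t (min (a + (t - a) * s) (b - (b - t) * σ))
  have hfix : ∀ t, t ≤ a ∨ b ≤ t → F t = t := by
    rintro t (ht | ht)
    · exact max_eq_left (min_le_of_left_le (by nlinarith))
    · exact max_eq_left (min_le_of_right_le (by nlinarith))
  have hmono : StrictMono F := by
    intro t t' h
    have h1 : a + (t - a) * s < a + (t' - a) * s := by nlinarith
    have h2 : b - (b - t) * σ < b - (b - t') * σ := by nlinarith
    exact max_lt_max h (min_lt_min h1 h2)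
  have hsurj : Function.Surjective F := by
    refine Continuous.surjective (by fun_prop) ?_ ?_
    · exact Filter.tendsto_atTop_mono (fun t => le_max_left _ _) Filter.tendsto_id
    · refine Filter.Tendsto.congr' ?_ Filter.tendsto_id
      filter_upwards [Filter.eventually_le_atBot a] with t ht
      exact (hfix t (Or.inl ht)).symm
  refine ⟨hmono.orderIsoOfSurjective F hsurj, ?_, hfix⟩
  change max w (min (a + (w - a) * s) (b - (b - w) * σ)) = z
  have h1 : a + (w - a) * s = z := by rw [hs]; field_simp; ring
  have h2 : b - (b - w) * σ = z := by rw [hσ]; field_simp; ring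
  rw [h1, h2, min_self, max_eq_right hwz]

lemma exists_orderIso_fix {a w z b : ℝ} (haw : a < w) (hwb : w < b) (haz : a < z) (hzb : z < b) :
    ∃ h : ℝ ≃o ℝ, h w = z ∧ ∀ t, t ≤ a ∨ b ≤ t → h t = t := by
  rcases le_total w z with hwz | hwz
  · exact exists_orderIso_fix_of_le haw hwz hzb
  · obtain ⟨h, h1, h2⟩ := exists_orderIso_fix_of_le haz hwz hwb
    exact ⟨h.symm, by rw [← h1, h.symm_apply_apply],
      fun t ht => by rw [OrderIso.symm_apply_eq, h2 t ht]⟩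

open Polynomial in
/-- The order automorphism `e` matches the signs of `p` and `q` on a finite set `R` that contains
the critical points of both (those of `q` pulled back along `e`) and surrounds their roots. -/
structure MatchesOn (p q : ℝ[X]) (e : ℝ ≃o ℝ) (R : Finset ℝ) : Prop where
  sign_eq : ∀ r ∈ R, SignType.sign (p.eval r) = SignType.sign (q.eval (e r))
  critical_left : ∀ r, p.derivative.eval r = 0 → r ∈ R
  critical_right : ∀ r, q.derivative.eval (e r) = 0 → r ∈ R
  surround_left : ∀ r, p.eval r = 0 → (∃ u ∈ R, u < r) ∧ ∃ v ∈ R, r < v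
  surround_right : ∀ r, q.eval (e r) = 0 → (∃ u ∈ R, u < r) ∧ ∃ v ∈ R, r < v

namespace MatchesOn

open Polynomial

variable {p q : ℝ[X]} {e : ℝ ≃o ℝ} {R : Finset ℝ}

lemma symm (h : MatchesOn p q e R) : MatchesOn q p e.symm (R.image e) where
  sign_eq := by
    intro r hr
    obtain ⟨s, hs, rfl⟩ := Finset.mem_image.1 hr
    simpa using (h.sign_eq s hs).symm
  critical_left := fun r hr =>
    Finset.mem_image.2 ⟨e.symm r, h.critical_right _ (by simpa using hr), by simp⟩
  critical_right := fun r hr =>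
    Finset.mem_image.2 ⟨e.symm r, h.critical_left _ hr, by simp⟩
  surround_left := by
    intro r hr
    obtain ⟨⟨u, hu, hur⟩, v, hv, hrv⟩ := h.surround_right (e.symm r) (by simpa using hr)
    exact ⟨⟨e u, Finset.mem_image_of_mem _ hu, e.lt_symm_apply.1 hur⟩,
      e v, Finset.mem_image_of_mem _ hv, e.symm_apply_lt.1 hrv⟩
  surround_right := by
    intro r hr
    obtain ⟨⟨u, hu, hur⟩, v, hv, hrv⟩ := h.surround_left (e.symm r) hr
    exact ⟨⟨e u, Finset.mem_image_of_mem _ hu, e.lt_symm_apply.1 hur⟩,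
      e v, Finset.mem_image_of_mem _ hv, e.symm_apply_lt.1 hrv⟩

/-- Neighbours in `R` of a point outside `R` lying between two points of `R`. -/
lemma _root_.Finset.exists_neighbours {R : Finset ℝ} {z : ℝ} (hz : z ∉ R)
    (hu : ∃ u ∈ R, u < z) (hv : ∃ v ∈ R, z < v) :
    ∃ u ∈ R, ∃ v ∈ R, u < z ∧ z < v ∧ ∀ t ∈ R, t ≤ u ∨ v ≤ t := by
  obtain ⟨u, hu⟩ := (R.filter (· < z)).exists_maximal (by simpa [Finset.Nonempty] using hu)
  obtain ⟨v, hv⟩ := (R.filter (z < ·)).exists_minimal (by simpa [Finset.Nonempty] using hv)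
  have hu1 := Finset.mem_filter.1 hu.prop
  have hv1 := Finset.mem_filter.1 hv.prop
  refine ⟨u, hu1.1, v, hv1.1, hu1.2, hv1.2, fun t ht => ?_⟩
  rcases lt_trichotomy t z with h | h | h
  · left
    by_contra! hc
    exact absurd (hu.le_of_ge (Finset.mem_filter.2 ⟨ht, h⟩) hc.le) (not_le.2 hc)
  · exact absurd (h ▸ ht) hz
  · right
    by_contra! hc
    exact absurd (hv.le_of_le (Finset.mem_filter.2 ⟨ht, h⟩) hc.le) (not_le.2 hc)

/-- A polynomial with a root strictly between `u` and `v` and no critical point strictly between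
them takes values of opposite sign at `u` and `v`. -/
lemma _root_.Polynomial.eval_mul_eval_neg {p : ℝ[X]} {u z v : ℝ} (huz : u < z) (hzv : z < v)
    (hz : p.eval z = 0) (hcrit : ∀ r, u < r → r < v → p.derivative.eval r ≠ 0) :
    p.eval u * p.eval v < 0 := by
  have key : StrictMonoOn (fun r => p.eval r) (Set.Icc u v) ∨
      StrictAntiOn (fun r => p.eval r) (Set.Icc u v) := by
    have hd := hasDerivWithinAt_forall_lt_or_forall_gt_of_forall_ne (convex_Ioo u v)
      (f := fun r => p.eval r) (f' := fun r => p.derivative.eval r) (m := 0)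
      (fun x _ => (p.hasDerivAt x).hasDerivWithinAt) (fun x hx => hcrit x hx.1 hx.2)
    rcases hd with hd | hd
    · right
      refine strictAntiOn_of_deriv_neg (convex_Icc u v) p.continuous.continuousOn fun x hx => ?_
      rw [interior_Icc] at hx
      simpa using hd x hx
    · left
      refine strictMonoOn_of_deriv_pos (convex_Icc u v) p.continuous.continuousOn fun x hx => ?_
      rw [interior_Icc] at hx
      simpa using hd x hx
  have hu : u ∈ Set.Icc u v := ⟨le_rfl, by linarith⟩
  have hv : v ∈ Set.Icc u v := ⟨by linarith, le_rfl⟩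
  have hzz : z ∈ Set.Icc u v := ⟨huz.le, hzv.le⟩
  rcases key with h | h
  · have h1 := h hu hzz huz
    have h2 := h hzz hv hzv
    simp only [hz] at h1 h2
    exact mul_neg_of_neg_of_pos h1 h2
  · have h1 := h hu hzz huz
    have h2 := h hzz hv hzv
    simp only [hz] at h1 h2
    exact mul_neg_of_pos_of_neg h1 h2

lemma _root_.Polynomial.exists_root_of_mul_neg {p : ℝ[X]} {u v : ℝ} (huv : u < v)
    (h : p.eval u * p.eval v < 0) : ∃ z, u < z ∧ z < v ∧ p.eval z = 0 := by
  rcases mul_neg_iff.1 h with ⟨h1, h2⟩ | ⟨h1, h2⟩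
  · obtain ⟨z, hz, hz0⟩ := intermediate_value_Ioo' huv.le p.continuous.continuousOn
      (show (0 : ℝ) ∈ Set.Ioo _ _ from ⟨h2, h1⟩)
    exact ⟨z, hz.1, hz.2, hz0⟩
  · obtain ⟨z, hz, hz0⟩ := intermediate_value_Ioo huv.le p.continuous.continuousOn
      (show (0 : ℝ) ∈ Set.Ioo _ _ from ⟨h1, h2⟩)
    exact ⟨z, hz.1, hz.2, hz0⟩

lemma _root_.Polynomial.sign_eval_eq {p : ℝ[X]} {u v : ℝ} (huv : u ≤ v)
    (h : ∀ r, u ≤ r → r ≤ v → p.eval r ≠ 0) :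
    SignType.sign (p.eval u) = SignType.sign (p.eval v) := by
  rcases huv.eq_or_lt with rfl | huv
  · rfl
  have hu := h u le_rfl huv.le
  have hv := h v huv.le le_rfl
  by_contra hne
  have hneg : p.eval u * p.eval v < 0 := by
    rcases hu.lt_or_gt with h1 | h1 <;> rcases hv.lt_or_gt with h2 | h2
    · simp [h1, h2] at hne
    · exact mul_neg_of_neg_of_pos h1 h2
    · exact mul_neg_of_pos_of_neg h1 h2
    · simp [h1, h2] at hne
  obtain ⟨z, h1, h2, h3⟩ := Polynomial.exists_root_of_mul_neg huv hneg
  exact h z h1.le h2.le h3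

lemma _root_.mul_neg_of_sign_eq {a b c d : ℝ} (hac : SignType.sign a = SignType.sign c)
    (hbd : SignType.sign b = SignType.sign d) (h : a * b < 0) : c * d < 0 := by
  rw [← sign_eq_neg_one_iff, sign_mul] at h ⊢
  rw [← hac, ← hbd, h]

lemma insert_root (h : MatchesOn p q e R) {z : ℝ} (hz : p.eval z = 0) (hzR : z ∉ R) :
    ∃ e' : ℝ ≃o ℝ, (∀ r ∈ R, e' r = e r) ∧ MatchesOn p q e' (insert z R) := by
  obtain ⟨hu, hv⟩ := h.surround_left z hz
  obtain ⟨u, hu, v, hv, huz, hzv, hgap⟩ := Finset.exists_neighbours hzR hu hv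
  have hneg : p.eval u * p.eval v < 0 := by
    refine Polynomial.eval_mul_eval_neg huz hzv hz fun r hr1 hr2 hr0 => ?_
    rcases hgap r (h.critical_left r hr0) with h1 | h1 <;> linarith
  have hneg' := mul_neg_of_sign_eq (h.sign_eq u hu) (h.sign_eq v hv) hneg
  obtain ⟨z', hz1, hz2, hz0⟩ :=
    Polynomial.exists_root_of_mul_neg (e.lt_iff_lt.2 (huz.trans hzv)) hneg'
  obtain ⟨g, hg, hfix⟩ :=
    exists_orderIso_fix (e.lt_iff_lt.2 huz) (e.lt_iff_lt.2 hzv) hz1 hz2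
  have hagree : ∀ r ∈ R, (e.trans g) r = e r := by
    intro r hr
    rw [OrderIso.trans_apply]
    apply hfix
    simpa using hgap r hr
  have hez : (e.trans g) z = z' := by rw [OrderIso.trans_apply, hg]
  refine ⟨e.trans g, hagree, ?_, ?_, ?_, ?_, ?_⟩
  · intro r hr
    rcases Finset.mem_insert.1 hr with rfl | hr
    · rw [hez, hz, hz0]
    · rw [hagree r hr, h.sign_eq r hr]
  · exact fun r hr => Finset.mem_insert_of_mem (h.critical_left r hr)
  · intro r hr
    have h0 := h.critical_right (e.symm ((e.trans g) r)) (by simpa using hr)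
    have h1 := hagree _ h0
    rw [OrderIso.apply_symm_apply] at h1
    rw [(e.trans g).injective h1] at h0
    exact Finset.mem_insert_of_mem h0
  · intro r hr
    obtain ⟨⟨a, ha, har⟩, b, hb, hrb⟩ := h.surround_left r hr
    exact ⟨⟨a, Finset.mem_insert_of_mem ha, har⟩, b, Finset.mem_insert_of_mem hb, hrb⟩
  · intro r hr
    obtain ⟨⟨a, ha, har⟩, b, hb, hrb⟩ :=
      h.surround_right (e.symm ((e.trans g) r)) (by simpa using hr)
    rw [e.lt_symm_apply, ← hagree a ha, OrderIso.lt_iff_lt] at har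
    rw [e.symm_apply_lt, ← hagree b hb, OrderIso.lt_iff_lt] at hrb
    exact ⟨⟨a, Finset.mem_insert_of_mem ha, har⟩, b, Finset.mem_insert_of_mem hb, hrb⟩

lemma insert_roots (h : MatchesOn p q e R) (Z : Finset ℝ) (hZ : ∀ z ∈ Z, p.eval z = 0) :
    ∃ (e' : ℝ ≃o ℝ) (R' : Finset ℝ), R ⊆ R' ∧ Z ⊆ R' ∧ (∀ r ∈ R, e' r = e r) ∧
      MatchesOn p q e' R' := by
  induction Z using Finset.induction_on with
  | empty => exact ⟨e, R, subset_rfl, by simp, fun _ _ => rfl, h⟩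
  | insert z Z _ ih =>
    obtain ⟨e₁, R₁, hR, hZR, hag, h₁⟩ := ih fun w hw => hZ w (Finset.mem_insert_of_mem hw)
    by_cases hz : z ∈ R₁
    · exact ⟨e₁, R₁, hR, Finset.insert_subset hz hZR, hag, h₁⟩
    · obtain ⟨e₂, hag₂, h₂⟩ := h₁.insert_root (hZ z (Finset.mem_insert_self _ _)) hz
      exact ⟨e₂, insert z R₁, hR.trans (Finset.subset_insert _ _),
        Finset.insert_subset_insert _ hZR,
        fun r hr => by rw [hag₂ r (hR hr), hag r hr], h₂⟩

lemma sign_eq_of_nonroot (h : MatchesOn p q e R) (hp : ∀ r, p.eval r = 0 → r ∈ R)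
    (hq : ∀ r, q.eval (e r) = 0 → r ∈ R) {u r : ℝ} (hu : u ∈ R) (hu0 : p.eval u ≠ 0)
    (hgap : ∀ t ∈ R, t = u ∨ ((t < u ∨ r < t) ∧ (t < r ∨ u < t))) :
    SignType.sign (p.eval r) = SignType.sign (q.eval (e r)) := by
  have hq0 : q.eval (e u) ≠ 0 := by
    intro h0
    have := h.sign_eq u hu
    rw [h0, sign_zero, sign_eq_zero_iff] at this
    exact hu0 this
  have hp1 : ∀ s, (u ≤ s ∧ s ≤ r ∨ r ≤ s ∧ s ≤ u) → p.eval s ≠ 0 := by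
    intro s hs h0
    rcases hgap s (hp s h0) with rfl | h1
    · exact hu0 h0
    · grind
  have hq1 : ∀ s, (e u ≤ s ∧ s ≤ e r ∨ e r ≤ s ∧ s ≤ e u) → q.eval s ≠ 0 := by
    intro s hs h0
    obtain ⟨s, rfl⟩ := e.surjective s
    simp only [e.le_iff_le] at hs
    rcases hgap s (hq s h0) with rfl | h1
    · exact hq0 h0
    · grind
  rcases le_total u r with hur | hur
  · rw [← Polynomial.sign_eval_eq hur fun s h1 h2 => hp1 s (Or.inl ⟨h1, h2⟩),
      ← Polynomial.sign_eval_eq (e.le_iff_le.2 hur) fun s h1 h2 => hq1 s (Or.inl ⟨h1, h2⟩)]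
    exact h.sign_eq u hu
  · rw [Polynomial.sign_eval_eq hur fun s h1 h2 => hp1 s (Or.inr ⟨h1, h2⟩),
      Polynomial.sign_eval_eq (e.le_iff_le.2 hur) fun s h1 h2 => hq1 s (Or.inr ⟨h1, h2⟩)]
    exact h.sign_eq u hu

lemma sign_eq_of_roots (h : MatchesOn p q e R) (hR : R.Nonempty)
    (hp : ∀ r, p.eval r = 0 → r ∈ R) (hq : ∀ r, q.eval (e r) = 0 → r ∈ R) (r : ℝ) :
    SignType.sign (p.eval r) = SignType.sign (q.eval (e r)) := by
  by_cases hr : r ∈ R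
  · exact h.sign_eq r hr
  by_cases hl : ∃ u ∈ R, u < r
  · by_cases hv : ∃ v ∈ R, r < v
    · obtain ⟨u, hu, v, hv, hur, hrv, hgap⟩ := Finset.exists_neighbours hr hl hv
      by_cases hu0 : p.eval u = 0
      · have hv0 : p.eval v ≠ 0 := by
          intro hv0
          obtain ⟨c, hc, hc0⟩ := exists_hasDerivAt_eq_zero (hur.trans hrv)
            p.continuous.continuousOn (hu0.trans hv0.symm) (fun x _ => p.hasDerivAt x)
          rcases hgap c (h.critical_left c hc0) with h1 | h1
          · exact absurd hc.1 (not_lt.2 h1)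
          · exact absurd hc.2 (not_lt.2 h1)
        refine h.sign_eq_of_nonroot hp hq hv hv0 fun t ht => ?_
        grind
      · refine h.sign_eq_of_nonroot hp hq hu hu0 fun t ht => ?_
        grind
    · push Not at hv
      obtain ⟨u, hu⟩ := R.exists_maximal hR
      refine h.sign_eq_of_nonroot hp hq hu.prop ?_ fun t ht => ?_
      · intro h0
        obtain ⟨-, v, hv, huv⟩ := h.surround_left u h0
        exact absurd (hu.le_of_ge hv huv.le) (not_le.2 huv)
      · have h1 := hv t ht
        have h2 : t ≤ u := not_lt.1 fun hc => absurd (hu.le_of_ge ht hc.le) (not_le.2 hc)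
        have h3 := hv u hu.prop
        grind
  · push Not at hl
    obtain ⟨u, hu⟩ := R.exists_minimal hR
    refine h.sign_eq_of_nonroot hp hq hu.prop ?_ fun t ht => ?_
    · intro h0
      obtain ⟨⟨v, hv, huv⟩, -⟩ := h.surround_left u h0
      exact absurd (hu.le_of_le hv huv.le) (not_le.2 huv)
    · have h1 := hl t ht
      have h2 : u ≤ t := not_lt.1 fun hc => absurd (hu.le_of_le ht hc.le) (not_le.2 hc)
      have h3 := hl u hu.prop
      grind

/-- The automorphism can be changed off `R` so as to match the signs of `p` and `q` everywhere. -/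
theorem exists_forall_sign_eq (h : MatchesOn p q e R) (hR : R.Nonempty) (hp : p ≠ 0)
    (hq : q ≠ 0) :
    ∃ e' : ℝ ≃o ℝ, (∀ r ∈ R, e' r = e r) ∧
      ∀ r, SignType.sign (p.eval r) = SignType.sign (q.eval (e' r)) := by
  obtain ⟨e₁, R₁, hR₁, hZ₁, hag₁, h₁⟩ := h.insert_roots p.roots.toFinset (by simp [hp])
  obtain ⟨e₂, R₂, hR₂, hZ₂, hag₂, h₂⟩ := h₁.symm.insert_roots q.roots.toFinset (by simp [hq])
  have hag : ∀ r ∈ R₁, e₂.symm r = e₁ r := by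
    intro r hr
    rw [OrderIso.symm_apply_eq, hag₂ _ (Finset.mem_image_of_mem _ hr), e₁.symm_apply_apply]
  have hsub : R₁ ⊆ R₂.image e₂ := by
    intro r hr
    refine Finset.mem_image.2 ⟨e₁ r, hR₂ (Finset.mem_image_of_mem _ hr), ?_⟩
    rw [← hag r hr, OrderIso.apply_symm_apply]
  refine ⟨e₂.symm, fun r hr => by rw [hag r (hR₁ hr), hag₁ r hr], ?_⟩
  refine h₂.symm.sign_eq_of_roots (hR.mono (hR₁.trans hsub)) ?_ ?_
  · intro r hr
    exact hsub (hZ₁ (by simp [hp, hr]))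
  · intro r hr
    exact Finset.mem_image.2 ⟨e₂.symm r, hZ₂ (by simp [hq, hr]), by simp⟩

end MatchesOn

section SignTables

open Polynomial

lemma Polynomial.eventually_mul_derivative_pos {p : ℝ[X]} (hp : 0 < p.natDegree) :
    ∀ᶠ r in Filter.atTop, 0 < p.eval r * p.derivative.eval r := by
  have hp0 : p ≠ 0 := by rintro rfl; simp at hp
  have hlc : p.derivative.leadingCoeff = p.natDegree * p.leadingCoeff := by
    rw [leadingCoeff_derivative, mul_comm]
  have hd0 : p.derivative ≠ 0 := by
    rw [← leadingCoeff_ne_zero, hlc]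
    exact mul_ne_zero (by exact_mod_cast hp.ne') (leadingCoeff_ne_zero.2 hp0)
  have hdeg : 0 < (p * p.derivative).degree := by
    rw [← natDegree_pos_iff_degree_pos, natDegree_mul hp0 hd0]
    omega
  have hnn : 0 ≤ (p * p.derivative).leadingCoeff := by
    rw [leadingCoeff_mul, hlc]
    nlinarith [mul_nonneg (Nat.cast_nonneg (α := ℝ) p.natDegree)
      (mul_self_nonneg p.leadingCoeff)]
  filter_upwards [(tendsto_atTop_of_leadingCoeff_nonneg _ hdeg hnn).eventually_gt_atTop 0]
    with r hr
  simpa using hr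

lemma Polynomial.eventually_mul_derivative_neg {p : ℝ[X]} (hp : 0 < p.natDegree) :
    ∀ᶠ r in Filter.atBot, p.eval r * p.derivative.eval r < 0 := by
  have h := Polynomial.eventually_mul_derivative_pos (p := p.comp (-X))
    (by simpa [natDegree_comp] using hp)
  filter_upwards [Filter.tendsto_neg_atBot_atTop.eventually h] with r hr
  simp only [derivative_comp, derivative_neg, derivative_X, eval_mul, eval_comp, eval_neg,
    eval_X, neg_neg, eval_one] at hr
  linarith

lemma sign_eq_of_mul_pos {a b : ℝ} (h : 0 < a * b) : SignType.sign a = SignType.sign b := by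
  rcases mul_pos_iff.1 h with ⟨h1, h2⟩ | ⟨h1, h2⟩ <;> simp [h1, h2]

lemma sign_eq_of_mul_neg {a b : ℝ} (h : a * b < 0) : SignType.sign a = -SignType.sign b := by
  rcases mul_neg_iff.1 h with ⟨h1, h2⟩ | ⟨h1, h2⟩ <;> simp [h1, h2]

variable {A : Type*} [CommRing A]

/-- The points `x` and `y` of the real spectrum give the same sign to every element of `G`. -/
def SignAgree (G : Finset A) (x y : A →+* ℝ) : Prop :=
  ∀ a ∈ G, SignType.sign (x a) = SignType.sign (y a)

/-- The polynomials of `F`, specialized at `x` and at `y`, have the same table of signs. -/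
def SameTable (F : Multiset A[X]) (x y : A →+* ℝ) : Prop :=
  ∃ e : ℝ ≃o ℝ, ∀ P ∈ F, ∀ r,
    SignType.sign ((P.map x).eval r) = SignType.sign ((P.map y).eval (e r))

lemma SignAgree.mono {G G' : Finset A} {x y : A →+* ℝ} (h : SignAgree G' x y) (hG : G ⊆ G') :
    SignAgree G x y :=
  fun a ha => h a (hG ha)

/-- The combination of `P` and `Q` that cancels the leading term of `P`. -/
noncomputable def leadReduce (P Q : A[X]) : A[X] :=
  C Q.leadingCoeff * P - C P.leadingCoeff * (Q * X ^ (P.natDegree - Q.natDegree))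

/-- The combination of `P` and its derivative that cancels the leading term of `P`. -/
noncomputable def eulerReduce (P : A[X]) : A[X] :=
  C (P.natDegree : A) * P - derivative P * X

lemma Polynomial.natDegree_lt_of_coeff_eq_zero {P : A[X]} {n : ℕ} (hn : 0 < n)
    (hle : P.natDegree ≤ n) (h0 : P.coeff n = 0) : P.natDegree < n := by
  refine lt_of_le_of_ne hle fun h => ?_
  subst h
  rw [coeff_natDegree, leadingCoeff_eq_zero] at h0
  simp [h0] at hn

lemma natDegree_leadReduce_lt {P Q : A[X]} (hP : 0 < P.natDegree)
    (hQ : Q.natDegree ≤ P.natDegree) : (leadReduce P Q).natDegree < P.natDegree := by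
  refine Polynomial.natDegree_lt_of_coeff_eq_zero hP ?_ ?_
  · rw [leadReduce]
    refine (natDegree_sub_le _ _).trans (max_le (natDegree_C_mul_le _ _) ?_)
    refine (natDegree_C_mul_le _ _).trans (natDegree_mul_le.trans ?_)
    have := natDegree_X_pow_le (R := A) (P.natDegree - Q.natDegree)
    omega
  · have h : (Q * X ^ (P.natDegree - Q.natDegree)).coeff P.natDegree = Q.leadingCoeff := by
      conv_lhs => rw [← Nat.add_sub_of_le hQ]
      rw [Nat.add_sub_cancel_left, coeff_mul_X_pow, leadingCoeff]
    rw [leadReduce, coeff_sub, coeff_C_mul, coeff_C_mul, h, coeff_natDegree, mul_comm, sub_self]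

lemma natDegree_eulerReduce_lt {P : A[X]} (hP : 0 < P.natDegree) :
    (eulerReduce P).natDegree < P.natDegree := by
  refine Polynomial.natDegree_lt_of_coeff_eq_zero hP ?_ ?_
  · rw [eulerReduce]
    refine (natDegree_sub_le _ _).trans (max_le (natDegree_C_mul_le _ _) ?_)
    refine natDegree_mul_le.trans ?_
    have h1 := natDegree_X_le (R := A)
    have h2 := natDegree_derivative_lt hP.ne'
    omega
  · obtain ⟨m, hm⟩ := Nat.exists_eq_succ_of_ne_zero hP.ne'
    rw [eulerReduce, coeff_sub, coeff_C_mul, hm, Nat.succ_eq_add_one, coeff_mul_X,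
      coeff_derivative]
    push_cast
    ring

lemma eval_map_leadReduce {P Q : A[X]} {x : A →+* ℝ} {r : ℝ} (hr : (Q.map x).eval r = 0) :
    ((leadReduce P Q).map x).eval r = x Q.leadingCoeff * (P.map x).eval r := by
  simp [leadReduce, hr]

lemma eval_map_eulerReduce {P : A[X]} {x : A →+* ℝ} {r : ℝ}
    (hr : (P.map x).derivative.eval r = 0) :
    ((eulerReduce P).map x).eval r = P.natDegree * (P.map x).eval r := by
  rw [derivative_map] at hr
  simp [eulerReduce, hr]

/-- The polynomials whose sign table determines that of `P ::ₘ F`. -/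
noncomputable def tableReduct (P : A[X]) (F : Multiset A[X]) : Multiset A[X] :=
  derivative P ::ₘ eulerReduce P ::ₘ F.map (leadReduce P)

lemma SameTable.of_tableReduct {P : A[X]} {F : Multiset A[X]} {x y : A →+* ℝ}
    (hP : 0 < P.natDegree) (hPx : x P.leadingCoeff ≠ 0) (hPy : y P.leadingCoeff ≠ 0)
    (hsign : ∀ Q ∈ F, SignType.sign (x Q.leadingCoeff) = SignType.sign (y Q.leadingCoeff))
    (hF : ∀ Q ∈ F, 0 < Q.natDegree → x Q.leadingCoeff ≠ 0)
    (h : SameTable (F + tableReduct P F) x y) : SameTable (P ::ₘ F) x y := by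
  classical
  obtain ⟨e, he⟩ := h
  have hdx : (P.map x).natDegree = P.natDegree := natDegree_map_of_leadingCoeff_ne_zero x hPx
  have hdy : (P.map y).natDegree = P.natDegree := natDegree_map_of_leadingCoeff_ne_zero y hPy
  have hx0 : P.map x ≠ 0 := by intro h0; rw [h0] at hdx; simp at hdx; omega
  have hy0 : P.map y ≠ 0 := by intro h0; rw [h0] at hdy; simp at hdy; omega
  have hn : (0 : ℝ) < P.natDegree := by exact_mod_cast hP
  have hder : ∀ r, SignType.sign ((P.map x).derivative.eval r) =
      SignType.sign ((P.map y).derivative.eval (e r)) := by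
    intro r
    rw [derivative_map, derivative_map]
    exact he _ (by simp [tableReduct]) r
  have hder0 : (P.map x).derivative ≠ 0 := by
    intro h0
    have := derivative_eq_zero.1 h0
    omega
  have heuler : ∀ r, (P.map x).derivative.eval r = 0 →
      SignType.sign ((P.map x).eval r) = SignType.sign ((P.map y).eval (e r)) := by
    intro r hr
    have hr' : (P.map y).derivative.eval (e r) = 0 := by
      rw [← sign_eq_zero_iff, ← hder, hr, sign_zero]
    have := he (eulerReduce P) (by simp [tableReduct]) r
    rwa [eval_map_eulerReduce hr, eval_map_eulerReduce hr', sign_mul, sign_mul, sign_pos hn,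
      one_mul, one_mul] at this
  have hlead : ∀ Q ∈ F, ∀ r, Q.map x ≠ 0 → (Q.map x).eval r = 0 →
      SignType.sign ((P.map x).eval r) = SignType.sign ((P.map y).eval (e r)) := by
    intro Q hQ r hQ0 hr
    have hQd : 0 < Q.natDegree := by
      by_contra! hc
      rw [Nat.le_zero] at hc
      obtain ⟨a, rfl⟩ := natDegree_eq_zero.1 hc
      rw [map_C] at hr hQ0
      rw [eval_C] at hr
      simp [hr] at hQ0
    have hr' : (Q.map y).eval (e r) = 0 := by
      rw [← sign_eq_zero_iff, ← he Q (by simp [hQ]), hr, sign_zero]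
    have := he (leadReduce P Q) (by
      simp only [tableReduct, Multiset.mem_add, Multiset.mem_cons, Multiset.mem_map]
      exact Or.inr (Or.inr (Or.inr ⟨Q, hQ, rfl⟩))) r
    rw [eval_map_leadReduce hr, eval_map_leadReduce hr', sign_mul, sign_mul, ← hsign Q hQ] at this
    exact mul_left_cancel₀ (sign_ne_zero.2 (hF Q hQ hQd)) this
  obtain ⟨M, hM⟩ := Filter.eventually_atTop.1
    ((Polynomial.eventually_mul_derivative_pos (hdx ▸ hP)).and
      (e.tendsto_atTop.eventually (Polynomial.eventually_mul_derivative_pos (hdy ▸ hP))))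
  obtain ⟨N, hN⟩ := Filter.eventually_atBot.1
    ((Polynomial.eventually_mul_derivative_neg (hdx ▸ hP)).and
      (e.tendsto_atBot.eventually (Polynomial.eventually_mul_derivative_neg (hdy ▸ hP))))
  have hsurr : ∀ r, ((P.map x).eval r = 0 ∨ (P.map y).eval (e r) = 0) → N < r ∧ r < M := by
    intro r hr
    constructor
    · by_contra! hc
      rcases hr with hr | hr
      · simpa [hr] using (hN r hc).1
      · simpa [hr] using (hN r hc).2
    · by_contra! hc
      rcases hr with hr | hr
      · simpa [hr] using (hM r hc).1
      · simpa [hr] using (hM r hc).2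
  let R : Finset ℝ := insert M (insert N ((P.map x).derivative.roots.toFinset ∪
    F.toFinset.biUnion fun Q => (Q.map x).roots.toFinset))
  have hderR : ∀ r, (P.map x).derivative.eval r = 0 → r ∈ R := fun r hr =>
    Finset.mem_insert_of_mem (Finset.mem_insert_of_mem (Finset.mem_union_left _
      (Multiset.mem_toFinset.2 (mem_roots'.2 ⟨hder0, hr⟩))))
  have hmatch : MatchesOn (P.map x) (P.map y) e R := by
    refine ⟨?_, ?_, ?_, ?_, ?_⟩
    · intro r hr
      simp only [R, Finset.mem_insert, Finset.mem_union, Finset.mem_biUnion,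
        Multiset.mem_toFinset] at hr
      rcases hr with rfl | rfl | hr | ⟨Q, hQ, hr⟩
      · rw [sign_eq_of_mul_pos (hM r le_rfl).1, sign_eq_of_mul_pos (hM r le_rfl).2, hder]
      · rw [sign_eq_of_mul_neg (hN r le_rfl).1, sign_eq_of_mul_neg (hN r le_rfl).2, hder]
      · exact heuler r (mem_roots'.1 hr).2
      · exact hlead Q hQ r (mem_roots'.1 hr).1 (mem_roots'.1 hr).2
    · intro r hr
      exact hderR r hr
    · intro r hr
      have : (P.map x).derivative.eval r = 0 := by
        rw [← sign_eq_zero_iff, hder, hr, sign_zero]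
      exact hderR r this
    · intro r hr
      obtain ⟨h1, h2⟩ := hsurr r (Or.inl hr)
      exact ⟨⟨N, by simp [R], h1⟩, M, by simp [R], h2⟩
    · intro r hr
      obtain ⟨h1, h2⟩ := hsurr r (Or.inr hr)
      exact ⟨⟨N, by simp [R], h1⟩, M, by simp [R], h2⟩
  obtain ⟨e', hag, he'⟩ := hmatch.exists_forall_sign_eq ⟨M, by simp [R]⟩ hx0 hy0
  refine ⟨e', fun Q hQ r => ?_⟩
  rcases Multiset.mem_cons.1 hQ with rfl | hQ
  · exact he' r
  rw [he Q (by simp [hQ])]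
  by_cases hr : r ∈ R
  · rw [hag r hr]
  have hroot : Q.map x ≠ 0 → ∀ s, (Q.map y).eval (e s) = 0 → s ∈ R := by
    intro h0 s hs
    have : (Q.map x).eval s = 0 := by
      rw [← sign_eq_zero_iff, he Q (by simp [hQ]), hs, sign_zero]
    simp only [R, Finset.mem_insert, Finset.mem_union, Finset.mem_biUnion, Multiset.mem_toFinset]
    exact Or.inr (Or.inr (Or.inr ⟨Q, hQ, mem_roots'.2 ⟨h0, this⟩⟩))
  by_cases h0 : Q.map x = 0
  · have hz : ∀ s, (Q.map y).eval s = 0 := by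
      intro s
      have := he Q (by simp [hQ]) (e.symm s)
      rw [h0, eval_zero, sign_zero, e.apply_symm_apply] at this
      exact sign_eq_zero_iff.1 this.symm
    rw [hz, hz]
  have hne : ∀ s, (e r ≤ s ∧ s ≤ e' r ∨ e' r ≤ s ∧ s ≤ e r) → (Q.map y).eval s ≠ 0 := by
    intro s hs hs0
    obtain ⟨s, rfl⟩ := e.surjective s
    have hsR := hroot h0 s hs0
    rw [e.le_iff_le, e.le_iff_le, ← hag s hsR, e'.le_iff_le, e'.le_iff_le] at hs
    have : s = r := by rcases hs with ⟨h1, h2⟩ | ⟨h1, h2⟩ <;> linarith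
    exact hr (this ▸ hsR)
  rcases le_total (e r) (e' r) with hle | hle
  · exact Polynomial.sign_eval_eq hle fun s h1 h2 => hne s (Or.inl ⟨h1, h2⟩)
  · exact (Polynomial.sign_eval_eq hle fun s h1 h2 => hne s (Or.inr ⟨h1, h2⟩)).symm

lemma map_eraseLead_of_eq_zero {P : A[X]} {x : A →+* ℝ} (h : x P.leadingCoeff = 0) :
    P.eraseLead.map x = P.map x := by
  conv_rhs => rw [← eraseLead_add_C_mul_X_pow P, Polynomial.map_add, Polynomial.map_mul, map_C, h]
  rw [C_0, zero_mul, add_zero]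

/-- The sign table of finitely many polynomials over `A` at a point is determined by the signs of
finitely many elements of `A` at that point. -/
theorem exists_signAgree_imp_sameTable (F : Multiset A[X]) :
    ∃ G : Finset A, ∀ x y : A →+* ℝ, SignAgree G x y → SameTable F x y := by
  classical
  induction F using
    (InvImage.wf (fun F : Multiset A[X] => F.map natDegree)
      Multiset.wellFounded_isDershowitzMannaLT).induction with
  | _ F ih =>
  simp only [InvImage] at ih
  have herase : ∀ Q : A[X], ∃ G : Finset A, Q ∈ F → 0 < Q.natDegree →
      ∀ x y : A →+* ℝ, SignAgree G x y → SameTable (Q.eraseLead ::ₘ F.erase Q) x y := by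
    intro Q
    by_cases hQ : Q ∈ F ∧ 0 < Q.natDegree
    · obtain ⟨G, hG⟩ := ih (Q.eraseLead ::ₘ F.erase Q) (by
        refine ⟨(F.erase Q).map natDegree, {Q.eraseLead.natDegree}, {Q.natDegree}, by simp,
          ?_, ?_, ?_⟩
        · rw [Multiset.map_cons, ← Multiset.singleton_add, add_comm]
        · conv_lhs => rw [← Multiset.cons_erase hQ.1]
          rw [Multiset.map_cons, ← Multiset.singleton_add, add_comm]
        · have := eraseLead_natDegree_le Q
          have := hQ.2
          simp
          omega)
      exact ⟨G, fun _ _ => hG⟩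
    · exact ⟨∅, fun h1 h2 => absurd ⟨h1, h2⟩ hQ⟩
  choose Ge hGe using herase
  by_cases hconst : ∀ P ∈ F, P.natDegree = 0
  · refine ⟨F.toFinset.image leadingCoeff, fun x y h => ⟨OrderIso.refl ℝ, fun P hP r => ?_⟩⟩
    have h1 := h P.leadingCoeff (Finset.mem_image_of_mem _ (by simpa using hP))
    obtain ⟨a, rfl⟩ := natDegree_eq_zero.1 (hconst P hP)
    simpa using h1
  push Not at hconst
  obtain ⟨P₀, hP₀, hP₀d⟩ := hconst
  obtain ⟨P, hPF, hmax⟩ := F.toFinset.exists_max_image natDegree ⟨P₀, by simpa using hP₀⟩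
  simp only [Multiset.mem_toFinset] at hPF hmax
  have hP : 0 < P.natDegree := lt_of_lt_of_le (Nat.pos_of_ne_zero hP₀d) (hmax P₀ hP₀)
  obtain ⟨Gr, hGr⟩ := ih (F.erase P + tableReduct P (F.erase P)) (by
    refine ⟨(F.erase P).map natDegree, (tableReduct P (F.erase P)).map natDegree,
      {P.natDegree}, by simp, by simp, ?_, ?_⟩
    · conv_lhs => rw [← Multiset.cons_erase hPF]
      rw [Multiset.map_cons, ← Multiset.singleton_add, add_comm]
    · intro m hm
      obtain ⟨Q, hQ, rfl⟩ := Multiset.mem_map.1 hm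
      refine ⟨_, Multiset.mem_singleton_self _, ?_⟩
      simp only [tableReduct, Multiset.mem_cons, Multiset.mem_map] at hQ
      rcases hQ with rfl | rfl | ⟨Q, hQ, rfl⟩
      · exact natDegree_derivative_lt hP.ne'
      · exact natDegree_eulerReduce_lt hP
      · exact natDegree_leadReduce_lt hP (hmax Q (Multiset.mem_of_mem_erase hQ)))
  refine ⟨Gr ∪ F.toFinset.image leadingCoeff ∪ F.toFinset.biUnion Ge, fun x y h => ?_⟩
  have hlc : ∀ Q ∈ F, SignType.sign (x Q.leadingCoeff) = SignType.sign (y Q.leadingCoeff) := by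
    intro Q hQ
    refine h _ (Finset.mem_union_left _ (Finset.mem_union_right _ ?_))
    exact Finset.mem_image_of_mem _ (by simpa using hQ)
  by_cases hdeg : ∃ Q ∈ F, 0 < Q.natDegree ∧ x Q.leadingCoeff = 0
  · obtain ⟨Q, hQ, hQd, hQx⟩ := hdeg
    have hQy : y Q.leadingCoeff = 0 := by
      rw [← sign_eq_zero_iff, ← hlc Q hQ, hQx, sign_zero]
    obtain ⟨e, he⟩ := hGe Q hQ hQd x y (h.mono fun a ha => Finset.mem_union_right _
      (Finset.mem_biUnion.2 ⟨Q, by simpa using hQ, ha⟩))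
    refine ⟨e, fun T hT r => ?_⟩
    rw [← Multiset.cons_erase hQ, Multiset.mem_cons] at hT
    rcases hT with rfl | hT
    · rw [← map_eraseLead_of_eq_zero hQx, ← map_eraseLead_of_eq_zero hQy]
      exact he _ (Multiset.mem_cons_self _ _) r
    · exact he T (Multiset.mem_cons_of_mem hT) r
  · push Not at hdeg
    have hPx := hdeg P hPF hP
    have hPy : y P.leadingCoeff ≠ 0 := by
      rw [← sign_ne_zero, ← hlc P hPF, sign_ne_zero]
      exact hPx
    have hsame := hGr x y (h.mono fun a ha =>
      Finset.mem_union_left _ (Finset.mem_union_left _ ha))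
    rw [← Multiset.cons_erase hPF]
    exact SameTable.of_tableReduct hP hPx hPy
      (fun Q hQ => hlc Q (Multiset.mem_of_mem_erase hQ))
      (fun Q hQ => hdeg Q (Multiset.mem_of_mem_erase hQ)) hsame

end SignTables

section SignDetermined

variable {ι κ : Type*}

/-- The truth of `Φ` at a point is determined by the signs of finitely many integer polynomials
at that point. -/
def SignDetermined (Φ : (ι → ℝ) → Prop) : Prop :=
  ∃ G : Finset (MvPolynomial ι ℤ), ∀ v w : ι → ℝ,
    SignAgree G (MvPolynomial.aeval v : _ →ₐ[ℤ] ℝ).toRingHom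
      (MvPolynomial.aeval w : _ →ₐ[ℤ] ℝ).toRingHom → (Φ v ↔ Φ w)

namespace SignDetermined

lemma not {Φ : (ι → ℝ) → Prop} (h : SignDetermined Φ) : SignDetermined fun v => ¬ Φ v := by
  obtain ⟨G, hG⟩ := h
  exact ⟨G, fun v w hvw => not_congr (hG v w hvw)⟩

lemma and {Φ Ψ : (ι → ℝ) → Prop} (hΦ : SignDetermined Φ) (hΨ : SignDetermined Ψ) :
    SignDetermined fun v => Φ v ∧ Ψ v := by
  classical
  obtain ⟨G, hG⟩ := hΦ
  obtain ⟨G', hG'⟩ := hΨ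
  exact ⟨G ∪ G', fun v w hvw => and_congr (hG v w (hvw.mono Finset.subset_union_left))
    (hG' v w (hvw.mono Finset.subset_union_right))⟩

lemma comp {Φ : (ι → ℝ) → Prop} (h : SignDetermined Φ) (σ : ι → κ) :
    SignDetermined fun v : κ → ℝ => Φ fun i => v (σ i) := by
  classical
  obtain ⟨G, hG⟩ := h
  refine ⟨G.image (MvPolynomial.rename σ), fun v w hvw => hG _ _ fun g hg => ?_⟩
  simpa [MvPolynomial.aeval_rename, Function.comp_def] using
    hvw _ (Finset.mem_image_of_mem _ hg)

/-- `g` as a polynomial in the variable `i` over a ring receiving the other variables. -/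
noncomputable def _root_.MvPolynomial.toUnivariate [DecidableEq ι] {B : Type*} [CommRing B]
    (i : ι) (b : ι → B) (g : MvPolynomial ι ℤ) : Polynomial B :=
  MvPolynomial.aeval (fun j => if j = i then Polynomial.X else Polynomial.C (b j)) g

lemma _root_.MvPolynomial.eval₂_toUnivariate [DecidableEq ι] {B : Type*} [CommRing B]
    (i : ι) (b : ι → B) (g : MvPolynomial ι ℤ) (φ : B →+* ℝ) (v : ι → ℝ)
    (hv : ∀ j, j ≠ i → φ (b j) = v j) (r : ℝ) :
    (g.toUnivariate i b).eval₂ φ r = MvPolynomial.aeval (Function.update v i r) g := by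
  induction g using MvPolynomial.induction_on with
  | C a =>
    rw [MvPolynomial.toUnivariate, MvPolynomial.aeval_C, MvPolynomial.aeval_C,
      Polynomial.algebraMap_apply, Polynomial.eval₂_C]
    simp
  | add p q hp hq =>
    rw [MvPolynomial.toUnivariate] at hp hq ⊢
    rw [map_add, Polynomial.eval₂_add, hp, hq, map_add]
  | mul_X p j hp =>
    rw [MvPolynomial.toUnivariate] at hp ⊢
    rw [map_mul, Polynomial.eval₂_mul, hp, map_mul, MvPolynomial.aeval_X, MvPolynomial.aeval_X]
    by_cases hj : j = i
    · subst hj; simp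
    · simp [hj, hv j hj]

/-- Tarski–Seidenberg: sign-determined predicates are closed under projection. -/
theorem exists_update [DecidableEq ι] {Φ : (ι → ℝ) → Prop} (h : SignDetermined Φ) (i : ι) :
    SignDetermined fun v => ∃ r, Φ (Function.update v i r) := by
  obtain ⟨G, hG⟩ := h
  obtain ⟨G', hG'⟩ := exists_signAgree_imp_sameTable
    (G.val.map (MvPolynomial.toUnivariate i (MvPolynomial.X (R := ℤ))))
  have hev : ∀ (v : ι → ℝ) (g : MvPolynomial ι ℤ) (r : ℝ),
      ((g.toUnivariate i MvPolynomial.X).map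
        (MvPolynomial.aeval v : _ →ₐ[ℤ] ℝ).toRingHom).eval r =
        MvPolynomial.aeval (Function.update v i r) g := by
    intro v g r
    rw [Polynomial.eval_map]
    exact MvPolynomial.eval₂_toUnivariate i _ g _ v (fun j _ => by simp) r
  refine ⟨G', fun v w hvw => ?_⟩
  obtain ⟨e, he⟩ := hG' _ _ hvw
  have key : ∀ r, Φ (Function.update v i r) ↔ Φ (Function.update w i (e r)) := by
    refine fun r => hG _ _ fun g hg => ?_
    have := he (g.toUnivariate i MvPolynomial.X) (Multiset.mem_map_of_mem _ hg) r
    rwa [hev, hev] at this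
  constructor
  · rintro ⟨r, hr⟩
    exact ⟨e r, (key r).1 hr⟩
  · rintro ⟨r, hr⟩
    exact ⟨e.symm r, (key _).2 (by simpa using hr)⟩

lemma exists_override [DecidableEq ι] {Φ : (ι → ℝ) → Prop} (h : SignDetermined Φ)
    (S : Finset ι) :
    SignDetermined fun v => ∃ w : ι → ℝ, Φ fun j => if j ∈ S then w j else v j := by
  induction S using Finset.induction_on with
  | empty => simpa using h
  | insert i S hi ih =>
    convert ih.exists_update i using 2 with v
    constructor
    · rintro ⟨w, hw⟩
      refine ⟨w i, w, ?_⟩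
      convert hw using 2 with j
      by_cases hj : j = i
      · subst hj; simp [hi]
      · simp [hj]
    · rintro ⟨r, w, hw⟩
      refine ⟨Function.update w i r, ?_⟩
      convert hw using 2 with j
      by_cases hj : j = i
      · subst hj; simp [hi]
      · simp [hj]

/-- The integer polynomial denoted by a term. -/
noncomputable def _root_.OFTerm.toMvPolynomial : OFTerm → MvPolynomial ℕ ℤ
  | .var i => MvPolynomial.X i
  | .zero => 0
  | .one => 1
  | .add s t => s.toMvPolynomial + t.toMvPolynomial
  | .mul s t => s.toMvPolynomial * t.toMvPolynomial
  | .neg t => -t.toMvPolynomial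

lemma _root_.OFTerm.aeval_toMvPolynomial (v : ℕ → ℝ) (t : OFTerm) :
    MvPolynomial.aeval v t.toMvPolynomial = t.eval v := by
  induction t <;> simp_all [OFTerm.toMvPolynomial, OFTerm.eval]

theorem realize (φ : OFFml) : SignDetermined fun v => φ.Realize v := by
  induction φ with
  | eq s t =>
    refine ⟨{s.toMvPolynomial - t.toMvPolynomial}, fun v w h => ?_⟩
    have := h _ (Finset.mem_singleton_self _)
    simp only [AlgHom.toRingHom_eq_coe, RingHom.coe_coe, map_sub,
      OFTerm.aeval_toMvPolynomial] at this
    change s.eval v = t.eval v ↔ s.eval w = t.eval w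
    rw [← sub_eq_zero, ← sign_eq_zero_iff, this, sign_eq_zero_iff, sub_eq_zero]
  | le s t =>
    refine ⟨{s.toMvPolynomial - t.toMvPolynomial}, fun v w h => ?_⟩
    have := h _ (Finset.mem_singleton_self _)
    simp only [AlgHom.toRingHom_eq_coe, RingHom.coe_coe, map_sub,
      OFTerm.aeval_toMvPolynomial] at this
    change s.eval v ≤ t.eval v ↔ s.eval w ≤ t.eval w
    rw [← sub_nonpos, ← sign_nonpos_iff, this, sign_nonpos_iff, sub_nonpos]
  | not φ h => exact h.not
  | and φ ψ hφ hψ => exact hφ.and hψ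
  | ex i φ h => exact h.exists_update i

/-- A sign-determined predicate that holds at a point whose `i`-th coordinate is transcendental
over the other ones still holds after some change of the `i`-th coordinate. -/
theorem exists_ne_update [DecidableEq ι] {Φ : (ι → ℝ) → Prop} (hΦ : SignDetermined Φ)
    {v : ι → ℝ} {i : ι} (B : Type*) [CommRing B] [Algebra B ℝ]
    (hB : ∀ j, j ≠ i → v j ∈ Set.range (algebraMap B ℝ)) (htr : Transcendental B (v i))
    (h : Φ v) : ∃ s, s ≠ v i ∧ Φ (Function.update v i s) := by
  obtain ⟨G, hG⟩ := hΦ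
  have hb : ∀ j, ∃ b : B, j ≠ i → algebraMap B ℝ b = v j := by
    intro j
    by_cases hj : j = i
    · exact ⟨0, fun h => absurd hj h⟩
    · obtain ⟨b, hb⟩ := hB j hj
      exact ⟨b, fun _ => hb⟩
  choose b hb using hb
  have hev : ∀ (g : MvPolynomial ι ℤ) (s : ℝ), Polynomial.aeval s (g.toUnivariate i b) =
      MvPolynomial.aeval (Function.update v i s) g :=
    fun g s => MvPolynomial.eval₂_toUnivariate i b g _ v hb s
  have hloc : ∀ g ∈ G, ∀ᶠ s in nhds (v i),
      SignType.sign (MvPolynomial.aeval v g) =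
        SignType.sign (MvPolynomial.aeval (Function.update v i s) g) := by
    intro g _
    have hv : MvPolynomial.aeval v g = Polynomial.aeval (v i) (g.toUnivariate i b) := by
      rw [hev, Function.update_eq_self]
    simp only [← hev]
    rw [hv]
    by_cases h0 : g.toUnivariate i b = 0
    · simp [h0]
    have hne : Polynomial.aeval (v i) (g.toUnivariate i b) ≠ 0 := fun hc => htr ⟨_, h0, hc⟩
    have hcont : Filter.Tendsto (fun s : ℝ => Polynomial.aeval s (g.toUnivariate i b))
        (nhds (v i)) (nhds (Polynomial.aeval (v i) (g.toUnivariate i b))) :=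
      (Polynomial.continuous_aeval _).tendsto _
    rcases hne.lt_or_gt with hlt | hgt
    · filter_upwards [hcont.eventually_lt_const hlt] with s hs
      rw [sign_neg hlt, sign_neg hs]
    · filter_upwards [hcont.eventually_const_lt hgt] with s hs
      rw [sign_pos hgt, sign_pos hs]
  have hall := (Filter.eventually_all_finset G).2 hloc
  obtain ⟨s, hs, hsne⟩ := ((hall.filter_mono nhdsWithin_le_nhds).and
    (self_mem_nhdsWithin (s := {v i}ᶜ))).exists
  exact ⟨s, hsne, (hG _ _ hs).1 h⟩

end SignDetermined

end SignDetermined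

/-- Over a countable subring of `ℝ` there are algebraically independent families of reals indexed
by any type of cardinality at most the continuum. -/
lemma exists_algebraicIndependent_real (K : Subalgebra ℤ ℝ) (hK : #K ≤ ℵ₀) (T : Type)
    (hT : #T ≤ Cardinal.continuum) : ∃ t : T → ℝ, AlgebraicIndependent K t := by
  obtain ⟨s, hs⟩ := exists_isTranscendenceBasis K ℝ
  have halg := hs.isAlgebraic
  have h1 := Algebra.IsAlgebraic.cardinalMk_le_max (Algebra.adjoin K (Set.range ((↑) : s → ℝ))) ℝ
  have h2 : #(Algebra.adjoin K (Set.range ((↑) : s → ℝ))) = #(MvPolynomial s K) :=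
    (Cardinal.mk_congr hs.1.aevalEquiv.toEquiv).symm
  have h3 : #(MvPolynomial s K) ≤ max (max #K #s) ℵ₀ := MvPolynomial.cardinalMk_le_max
  have h4 : Cardinal.continuum ≤ #s := by
    rw [Cardinal.mk_real, h2] at h1
    have h5 : Cardinal.continuum ≤ max #s ℵ₀ := by
      refine h1.trans (max_le (h3.trans ?_) (le_max_right _ _))
      exact max_le (max_le (hK.trans (le_max_right _ _)) (le_max_left _ _)) (le_max_right _ _)
    rcases le_max_iff.1 h5 with h | h
    · exact h
    · exact absurd h (not_le.2 Cardinal.aleph0_lt_continuum)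
  obtain ⟨j⟩ := Cardinal.le_def _ _ |>.1 (hT.trans h4)
  exact ⟨fun x => j x, hs.1.comp j j.injective⟩

/-- The valuation of the pair `(z, y)` with the given parameters. -/
def pairValuation {d : ℕ} (params : ℕ → ℝ) (z y : Fin d → ℝ) : ℕ ⊕ Fin d → ℝ :=
  Sum.elim (fun k => if h : k < d then z ⟨k, h⟩ else params k) y

/-- Equality of the values of a semialgebraic map is a sign-determined predicate. -/
lemma IsSemialgebraicGraph.exists_signDetermined {d n : ℕ} {f : (Fin d → ℝ) → Fin n → ℝ}
    (hf : IsSemialgebraicGraph d n f) :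
    ∃ (params : ℕ → ℝ) (Φ : (ℕ ⊕ Fin d → ℝ) → Prop), SignDetermined Φ ∧
      ∀ z y, Φ (pairValuation params z y) ↔ f z = f y := by
  obtain ⟨θ, params, hθ⟩ := hf
  have hdet := SignDetermined.realize θ
  let σ : ℕ → ℕ ⊕ Fin d := fun k => if h : k < d then Sum.inr ⟨k, h⟩ else Sum.inl k
  have hpair := (hdet.comp (Sum.inl : ℕ → ℕ ⊕ Fin d)).and
    (hdet.comp σ)
  refine ⟨params, _, hpair.exists_override ((Finset.Ico d (d + n)).image Sum.inl),
    fun z y => ?_⟩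
  have key : ∀ w : ℕ ⊕ Fin d → ℝ,
      (θ.Realize (fun k => if (Sum.inl k : ℕ ⊕ Fin d) ∈ (Finset.Ico d (d + n)).image Sum.inl
        then w (Sum.inl k) else pairValuation params z y (Sum.inl k)) ↔
          f z = fun i : Fin n => w (Sum.inl (d + i))) ∧
      (θ.Realize (fun k => if σ k ∈ (Finset.Ico d (d + n)).image Sum.inl then w (σ k)
        else pairValuation params z y (σ k)) ↔ f y = fun i : Fin n => w (Sum.inl (d + i))) := by
    intro w
    rw [hθ, hθ]
    constructor
    · refine iff_of_eq (congrArg (fun v => θ.Realize v) (funext fun k => ?_))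
      by_cases h : k < d
      · simp [h, pairValuation]
      · by_cases h' : k - d < n
        · have : k < d + n := by omega
          simp [h, h', this, Nat.add_sub_of_le (not_lt.1 h), not_lt.1 h]
        · have : ¬ k < d + n := by omega
          simp [h, h', this, pairValuation]
    · refine iff_of_eq (congrArg (fun v => θ.Realize v) (funext fun k => ?_))
      by_cases h : k < d
      · simp [σ, h, pairValuation]
      · by_cases h' : k - d < n
        · have : k < d + n := by omega
          simp [σ, h, h', this, Nat.add_sub_of_le (not_lt.1 h), not_lt.1 h]
        · have : ¬ k < d + n := by omega
          simp [σ, h, h', this, pairValuation]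
  constructor
  · rintro ⟨w, hw1, hw2⟩
    exact ((key w).1.1 hw1).trans ((key w).2.1 hw2).symm
  · intro h
    let w : ℕ ⊕ Fin d → ℝ :=
      Sum.elim (fun k => if hk : k - d < n then f z ⟨k - d, hk⟩ else 0) fun _ => 0
    have hw : f z = fun i : Fin n => w (Sum.inl (d + i)) := by
      funext i
      simp [w]
    exact ⟨w, (key w).1.2 hw, (key w).2.2 (h ▸ hw)⟩

lemma update_pairValuation {d : ℕ} (params : ℕ → ℝ) (z y : Fin d → ℝ) (i : Fin d) (s : ℝ) :
    Function.update (pairValuation params z y) (Sum.inl (i : ℕ)) s =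
      pairValuation params (Function.update z i s) y := by
  funext j
  rcases j with k | k
  · by_cases hk : k = i
    · subst hk; simp [pairValuation]
    · by_cases h : k < d
      · have : (⟨k, h⟩ : Fin d) ≠ i := fun hc => hk (congrArg Fin.val hc)
        simp [pairValuation, h, hk, this]
      · simp [pairValuation, h, hk]
  · simp [pairValuation]

/-- A semialgebraic map that is one-to-one in each coordinate becomes injective after composition
with suitable injections of the coordinates. -/
theorem IsSemialgebraicGraph.exists_injective_comp {d n : ℕ} {f : (Fin d → ℝ) → Fin n → ℝ}
    (hf : IsSemialgebraicGraph d n f) (hone : OneToOneEachCoord f) :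
    ∃ τ : Fin d → ℝ → ℝ, (∀ i, Function.Injective (τ i)) ∧
      Function.Injective fun z : Fin d → ℝ => f fun i => τ i (z i) := by
  obtain ⟨params, Φ, hΦ, hΦf⟩ := hf.exists_signDetermined
  have hK : #(Algebra.adjoin ℤ (Set.range params)) ≤ ℵ₀ := by
    rw [Algebra.adjoin_range_eq_range_aeval]
    exact Cardinal.mk_range_le.trans (MvPolynomial.cardinalMk_le_max.trans (by simp))
  obtain ⟨t, ht⟩ := exists_algebraicIndependent_real _ hK (Fin d × ℝ) (by
    rw [Cardinal.mk_prod, Cardinal.lift_id, Cardinal.lift_id, Cardinal.mk_real]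
    exact Cardinal.mul_le_of_le Cardinal.aleph0_le_continuum
      (Cardinal.mk_le_aleph0.trans Cardinal.aleph0_le_continuum) le_rfl)
  refine ⟨fun i x => t (i, x), fun i x y h => (Prod.mk.inj (ht.injective h)).2,
    fun z y hzy => ?_⟩
  by_contra hne
  obtain ⟨i, hi⟩ := Function.ne_iff.1 hne
  set a : Fin d → ℝ := fun i => t (i, z i) with ha
  set b : Fin d → ℝ := fun i => t (i, y i) with hb
  have hai : pairValuation params a b (Sum.inl (i : ℕ)) = t (i, z i) := by simp [pairValuation, ha]
  have hmem : ∀ j, j ≠ Sum.inl (i : ℕ) → pairValuation params a b j ∈ Set.range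
      (algebraMap (Algebra.adjoin (Algebra.adjoin ℤ (Set.range params)) (t '' {(i, z i)}ᶜ)) ℝ) := by
    have ht' : ∀ q, q ≠ (i, z i) → t q ∈ Set.range
        (algebraMap (Algebra.adjoin (Algebra.adjoin ℤ (Set.range params))
          (t '' {(i, z i)}ᶜ)) ℝ) := fun q hq =>
      ⟨⟨t q, Algebra.subset_adjoin (Set.mem_image_of_mem t hq)⟩, rfl⟩
    rintro (k | k) hk
    · by_cases h : k < d
      · simp only [pairValuation, Sum.elim_inl, h, dif_pos, ha]
        refine ht' _ fun hc => hk ?_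
        rw [← (Prod.mk.inj hc).1]
      · simp only [pairValuation, Sum.elim_inl, h, dif_neg, not_false_iff]
        let c : Algebra.adjoin ℤ (Set.range params) :=
          ⟨params k, Algebra.subset_adjoin (Set.mem_range_self k)⟩
        exact ⟨algebraMap _ _ c, rfl⟩
    · simp only [pairValuation, Sum.elim_inr, hb]
      refine ht' _ fun hc => hi ?_
      obtain ⟨rfl, h2⟩ := Prod.mk.inj hc
      exact h2.symm
  obtain ⟨s, hs, hΦs⟩ := hΦ.exists_ne_update _ hmem
    (by rw [hai]; exact ht.transcendental_adjoin (by simp)) ((hΦf a b).2 hzy)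
  rw [update_pairValuation, hΦf] at hΦs
  refine hone (Function.update a i s) a ⟨i, ?_, fun j hj => ?_⟩ (hΦs.trans hzy.symm)
  · rw [hai] at hs
    simpa using hs
  · rw [Function.update_of_ne hj]

lemma mem_fimg {V W : Type*} {g : V → W} {e : Finset V} {y : W} :
    y ∈ fimg g e ↔ ∃ x ∈ e, g x = y :=
  @Finset.mem_image _ _ (Classical.decEq W) g e y

lemma card_fimg {V W : Type*} {g : V → W} (hg : Function.Injective g) (e : Finset V) :
    (fimg g e).card = e.card :=
  @Finset.card_image_of_injective _ _ g (Classical.decEq W) e hg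

lemma fimg_fimg {U V W : Type*} (g : V → W) (h : U → V) (e : Finset U) :
    fimg g (fimg h e) = fimg (g ∘ h) e := by
  ext y
  simp [mem_fimg]

lemma fimg_mem_LEdges {k d : ℕ} {α X Y : Type*} {P : Finset (Fin d → α)} {τ : Fin d → X → Y}
    (hτ : ∀ i, Function.Injective (τ i)) {Q : Finset (Fin d → X)} (hQ : Q ∈ LEdges k P X) :
    fimg (fun z i => τ i (z i)) Q ∈ LEdges k P Y := by
  obtain ⟨hcard, g, hg1, hg2, hg3⟩ := hQ
  have hinj : Function.Injective fun (z : Fin d → X) i => τ i (z i) :=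
    fun z y h => funext fun i => hτ i (congrFun h i)
  refine ⟨?_, fun x i => τ i (g x i), fun x hx => ?_, fun y hy => ?_, fun x hx y hy i h => ?_⟩
  · rw [card_fimg hinj, hcard]
  · exact mem_fimg.2 ⟨g x, hg1 x hx, rfl⟩
  · obtain ⟨q, hq, rfl⟩ := mem_fimg.1 hy
    obtain ⟨x, hx, rfl⟩ := hg2 q hq
    exact ⟨x, hx, rfl⟩
  · exact congrArg (τ i) (hg3 x hx y hy i h)

/-- If `H` is an algebraic `k`-hypergraph, `P` is a `d`-dimensional `k`-template and
`L(ℝ^d,P)` is semialgebraically immersible into `H`, then `L(ℝ^d,P)` is embeddable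
into `H`. -/
theorem semialgebraic_immersible_embeddable {α : Type v} (k n d : ℕ)
    (p : MvPolynomial (Fin k × Fin n) ℝ) (P : Finset (Fin d → α)) (hP : P.card = k)
    (f : (Fin d → ℝ) → (Fin n → ℝ))
    (himm : IsImmersion k P (zeroEdges k n p) f)
    (hsa : IsSemialgebraicGraph d n f) :
    Embeddable (LEdges k P ℝ) (zeroEdges k n p) := by
  obtain ⟨τ, hτ, hinj⟩ := hsa.exists_injective_comp himm.1
  refine ⟨_, hinj, fun Q hQ => ?_⟩
  have hmem := himm.2 _ (fimg_mem_LEdges hτ hQ) (by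
    intro u hu v hv huv
    obtain ⟨u, -, rfl⟩ := mem_fimg.1 hu
    obtain ⟨v, -, rfl⟩ := mem_fimg.1 hv
    rw [hinj huv])
  rwa [fimg_fimg] at hmem
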